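/- Let X be a real m×n matrix (m ≥ n) with singular value decomposition X = UΣVᵀ, where U is m×n with orthonormal columns, V is n×n orthogonal, and Σ = diag(σ₁,…,σ_n) with σ₁ ≥ … ≥ σ_n ≥ 0. Fix 1 ≤ k < n and λ' with 0 < λ' < σ_k and σ_k > σ_{k+1}. Then the pair P = U_k · diag(√(σ₁−λ'), …, √(σ_k−λ')), Q = V_k · diag(√(σ₁−λ'), …, √(σ_k−λ')) minimizes the regularized matrix factorization objective ‖X − PQᵀ‖_F² + λ'(‖P‖_F² + ‖Q‖_F²) over all pairs of real matrices P ∈ ℝ^{m×k}, Q ∈ ℝ^{n×k}; moreover its product equals PQᵀ = U_k · diag(σ₁−λ', …, σ_k−λ') · V_kᵀ, so the optimal prediction scales the i-th singular value σ_i down to σ_i − λ' = σ_i(1 − λ'/σ_i). -/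

import Mathlib

open Matrix BigOperators

noncomputable def frobSq {m n : Type*} [Fintype m] [Fintype n] (A : Matrix m n ℝ) : ℝ :=
  ∑ i, ∑ j, (A i j) ^ 2

lemma frobSq_trace {m n : Type*} [Fintype m] [Fintype n] (A : Matrix m n ℝ) :
    frobSq A = (Aᵀ * A).trace := by
  unfold frobSq
  rw [Finset.sum_comm]
  simp [Matrix.trace, Matrix.mul_apply, sq]

lemma obj_expand {m n k : ℕ} (X : Matrix (Fin m) (Fin n) ℝ) (P : Matrix (Fin m) (Fin k) ℝ)
    (Q : Matrix (Fin n) (Fin k) ℝ) :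
    frobSq (X - P * Qᵀ) = frobSq X - 2 * (Pᵀ * (X * Q)).trace + (Pᵀ * P * (Qᵀ * Q)).trace := by
  simp only [frobSq_trace, transpose_sub, transpose_mul, transpose_transpose, Matrix.sub_mul,
    Matrix.mul_sub, trace_sub]
  have h1 : (Xᵀ * (P * Qᵀ)).trace = (Pᵀ * (X * Q)).trace := by
    rw [← trace_transpose]
    simp only [transpose_mul, transpose_transpose]
    rw [Matrix.mul_assoc, trace_mul_comm, Matrix.mul_assoc]
  have h2 : (Q * Pᵀ * X).trace = (Pᵀ * (X * Q)).trace := by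
    rw [Matrix.mul_assoc, trace_mul_comm, Matrix.mul_assoc]
  have h3 : (Q * Pᵀ * (P * Qᵀ)).trace = (Pᵀ * P * (Qᵀ * Q)).trace := by
    rw [Matrix.mul_assoc, trace_mul_comm]
    simp only [Matrix.mul_assoc]
  rw [h1, h2, h3]; ring

/-- The truncated gain of a singular value. -/
noncomputable def gain (l s : ℝ) : ℝ := (max (s - l) 0) ^ 2

lemma gain_nonneg (l s : ℝ) : 0 ≤ gain l s := sq_nonneg _

lemma gain_mono (l : ℝ) {s t : ℝ} (h : s ≤ t) : gain l s ≤ gain l t := by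
  unfold gain
  have : max (s - l) 0 ≤ max (t - l) 0 := max_le_max (by linarith) le_rfl
  have h0 : 0 ≤ max (s - l) 0 := le_max_right _ _
  gcongr

lemma gain_key (l s d : ℝ) (hl : 0 < l) (hs : 0 ≤ s) (hd : 0 < d) :
    -(d⁻¹ * gain l s) ≤ l - s ^ 2 / (d + l) := by
  have key : s ^ 2 * d ≤ (gain l s + l * d) * (d + l) := by
    unfold gain
    rcases le_total l s with h | h
    · rw [max_eq_left (by linarith)]
      nlinarith [mul_nonneg hl.le (sq_nonneg (s - l - d))]
    · rw [max_eq_right (by linarith)]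
      have : s ^ 2 ≤ l ^ 2 := by gcongr
      nlinarith [mul_le_mul_of_nonneg_right this hd.le, mul_pos hl (mul_pos hd hd)]
  have h2 : s ^ 2 / (d + l) ≤ (gain l s + l * d) / d := by
    rw [div_le_div_iff₀ (by positivity) hd]; exact key
  have h3 : (gain l s + l * d) / d = d⁻¹ * gain l s + l := by field_simp
  linarith

/-- Lower bound when the columns of `Q` are orthogonal. -/
lemma lower_diag {m n k : ℕ} (X U : Matrix (Fin m) (Fin n) ℝ) (V : Matrix (Fin n) (Fin n) ℝ)
    (σ : Fin n → ℝ) (hU : Uᵀ * U = 1) (hV : Vᵀ * V = 1)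
    (hσord : ∀ i j : Fin n, i ≤ j → σ j ≤ σ i) (hσnn : ∀ i, 0 ≤ σ i)
    (hX : X = U * Matrix.diagonal σ * Vᵀ) (hklt : k < n) (l : ℝ) (hl : 0 < l)
    (P : Matrix (Fin m) (Fin k) ℝ) (Q : Matrix (Fin n) (Fin k) ℝ) (d : Fin k → ℝ)
    (hQ : Qᵀ * Q = diagonal d) :
    frobSq X - ∑ i : Fin k, gain l (σ (Fin.castLE hklt.le i)) ≤
      frobSq (X - P * Qᵀ) + l * (frobSq P + frobSq Q) := by
  have hV' : V * Vᵀ = 1 := mul_eq_one_comm.mp hV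
  obtain ⟨R, hR⟩ : ∃ R, R = Vᵀ * Q := ⟨_, rfl⟩
  obtain ⟨Y, hY⟩ : ∃ Y, Y = X * Q := ⟨_, rfl⟩
  have hRR : Rᵀ * R = diagonal d := by
    rw [hR, transpose_mul, transpose_transpose, Matrix.mul_assoc, ← Matrix.mul_assoc V, hV',
      Matrix.one_mul, hQ]
  have hYR : Y = U * (diagonal σ * R) := by
    rw [hY, hX, hR]; simp only [Matrix.mul_assoc]
  have hYY : Yᵀ * Y = (diagonal σ * R)ᵀ * (diagonal σ * R) := by
    rw [hYR, transpose_mul, Matrix.mul_assoc, ← Matrix.mul_assoc Uᵀ, hU, Matrix.one_mul]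
  have hdR : ∀ j, d j = ∑ i, R i j ^ 2 := by
    intro j
    have := congrFun (congrFun hRR j) j
    simp only [Matrix.mul_apply, transpose_apply, diagonal_apply_eq] at this
    rw [← this]; simp [sq]
  have hYj : ∀ j, ∑ i, Y i j ^ 2 = ∑ i, σ i ^ 2 * R i j ^ 2 := by
    intro j
    have := congrFun (congrFun hYY j) j
    rw [Matrix.mul_apply, Matrix.mul_apply] at this
    simp only [transpose_apply, diagonal_mul] at this
    calc _ = ∑ i, Y i j * Y i j := by simp [sq]
      _ = _ := this
      _ = _ := Finset.sum_congr rfl (fun i _ => by ring)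
  have hd0 : ∀ j, 0 ≤ d j := fun j => by rw [hdR]; exact Finset.sum_nonneg fun i _ => sq_nonneg _
  -- Bessel
  have hrow : ∀ i, ∑ j, R i j ^ 2 * (d j)⁻¹ ≤ 1 := by
    intro i
    have hE : (1 - R * diagonal (fun j => (d j)⁻¹) * Rᵀ) * (1 - R * diagonal (fun j => (d j)⁻¹) * Rᵀ)ᵀ
        = 1 - R * diagonal (fun j => (d j)⁻¹) * Rᵀ := by
      have h1 : (R * diagonal (fun j => (d j)⁻¹) * Rᵀ) * (R * diagonal (fun j => (d j)⁻¹) * Rᵀ)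
          = R * diagonal (fun j => (d j)⁻¹) * Rᵀ := by
        calc _ = R * (diagonal (fun j => (d j)⁻¹) * (Rᵀ * R) * diagonal (fun j => (d j)⁻¹)) * Rᵀ := by
              simp only [Matrix.mul_assoc]
          _ = _ := by
              rw [hRR, diagonal_mul_diagonal, diagonal_mul_diagonal]
              congr 3
              ext j
              by_cases h : d j = 0
              · simp [h]
              · field_simp
      have h2 : (R * diagonal (fun j => (d j)⁻¹) * Rᵀ)ᵀ = R * diagonal (fun j => (d j)⁻¹) * Rᵀ := by
        simp only [transpose_mul, transpose_transpose, diagonal_transpose, Matrix.mul_assoc]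
      rw [transpose_sub, h2, transpose_one, Matrix.sub_mul, Matrix.mul_sub, Matrix.mul_sub, h1]
      simp
    have h := congrFun (congrFun hE i) i
    rw [Matrix.mul_apply] at h
    have hn : 0 ≤ (1 - R * diagonal (fun j => (d j)⁻¹) * Rᵀ : Matrix (Fin n) (Fin n) ℝ) i i := by
      rw [← h]
      exact Finset.sum_nonneg fun j _ => by rw [transpose_apply]; exact mul_self_nonneg _
    rw [Matrix.sub_apply, Matrix.one_apply_eq, Matrix.mul_apply] at hn
    simp only [mul_diagonal, transpose_apply] at hn
    have : ∑ j, R i j ^ 2 * (d j)⁻¹ = ∑ j, R i j * (d j)⁻¹ * R i j :=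
      Finset.sum_congr rfl (fun j _ => by ring)
    linarith
  have hcol : ∀ j, ∑ i, R i j ^ 2 * (d j)⁻¹ ≤ 1 := by
    intro j
    rw [← Finset.sum_mul, ← hdR]
    exact mul_inv_le_one
  -- column estimate
  have hterm : ∀ j, -∑ i, R i j ^ 2 * (d j)⁻¹ * gain l (σ i) ≤
      -2 * ∑ i, P i j * Y i j + (d j + l) * ∑ i, P i j ^ 2 + l * d j := by
    intro j
    have hp : 0 < d j + l := by linarith [hd0 j]
    have h1 : 0 ≤ ∑ i, ((d j + l) * P i j - Y i j) ^ 2 := Finset.sum_nonneg fun i _ => sq_nonneg _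
    have h2 : ∑ i, ((d j + l) * P i j - Y i j) ^ 2 = (d j + l) ^ 2 * ∑ i, P i j ^ 2
        - 2 * (d j + l) * ∑ i, P i j * Y i j + ∑ i, Y i j ^ 2 := by
      rw [Finset.mul_sum, Finset.mul_sum, ← Finset.sum_sub_distrib, ← Finset.sum_add_distrib]
      exact Finset.sum_congr rfl (fun i _ => by ring)
    have h3 : -((∑ i, Y i j ^ 2) / (d j + l)) ≤
        -2 * ∑ i, P i j * Y i j + (d j + l) * ∑ i, P i j ^ 2 := by
      rw [neg_le_iff_add_nonneg, ← mul_nonneg_iff_of_pos_left hp]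
      have : (d j + l) * (-2 * ∑ i, P i j * Y i j + (d j + l) * ∑ i, P i j ^ 2
          + (∑ i, Y i j ^ 2) / (d j + l)) = ∑ i, ((d j + l) * P i j - Y i j) ^ 2 := by
        rw [h2]; field_simp; ring
      rw [this]; exact h1
    have h4 : -∑ i, R i j ^ 2 * (d j)⁻¹ * gain l (σ i) ≤
        -((∑ i, Y i j ^ 2) / (d j + l)) + l * d j := by
      have : -((∑ i, Y i j ^ 2) / (d j + l)) + l * d j
          = ∑ i, R i j ^ 2 * (l - σ i ^ 2 / (d j + l)) := by
        rw [hYj, Finset.sum_div]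
        nth_rewrite 2 [hdR j]
        rw [Finset.mul_sum, ← Finset.sum_neg_distrib, ← Finset.sum_add_distrib]
        exact Finset.sum_congr rfl (fun i _ => by ring)
      rw [this, ← Finset.sum_neg_distrib]
      refine Finset.sum_le_sum fun i _ => ?_
      rcases (hd0 j).eq_or_lt with h | h
      · have hz : R i j ^ 2 = 0 := by
          have h0 := hdR j
          rw [← h] at h0
          exact (Finset.sum_eq_zero_iff_of_nonneg (fun i _ => sq_nonneg _)).1 h0.symm i
            (Finset.mem_univ _)
        simp [hz]
      · have := mul_le_mul_of_nonneg_left (gain_key l (σ i) (d j) hl (hσnn i) h)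
          (sq_nonneg (R i j))
        linarith
    linarith
  -- weights
  obtain ⟨t, ht⟩ : ∃ t : Fin n → ℝ, t = fun i => ∑ j, R i j ^ 2 * (d j)⁻¹ := ⟨_, rfl⟩
  have ht0 : ∀ i, 0 ≤ t i := fun i => by
    rw [ht]
    exact Finset.sum_nonneg fun j _ => mul_nonneg (sq_nonneg _) (inv_nonneg.2 (hd0 j))
  have ht1 : ∀ i, t i ≤ 1 := fun i => by rw [ht]; exact hrow i
  have htk : ∑ i, t i ≤ k := by
    rw [ht, Finset.sum_comm]
    calc _ ≤ ∑ j : Fin k, (1 : ℝ) := Finset.sum_le_sum fun j _ => hcol j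
      _ = k := by simp
  have hw : ∑ i, t i * gain l (σ i) ≤ ∑ i : Fin k, gain l (σ (Fin.castLE hklt.le i)) := by
    obtain ⟨g0, hg0⟩ : ∃ g0, g0 = gain l (σ ⟨k, hklt⟩) := ⟨_, rfl⟩
    have hg0n : 0 ≤ g0 := hg0 ▸ gain_nonneg _ _
    have hb : ∀ i, t i * (gain l (σ i) - g0) ≤
        if (i : ℕ) < k then gain l (σ i) - g0 else 0 := by
      intro i
      split_ifs with h
      · have : g0 ≤ gain l (σ i) := hg0 ▸ gain_mono l (hσord _ _ (Fin.le_def.2 h.le))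
        nlinarith [ht1 i]
      · have : gain l (σ i) ≤ g0 := hg0 ▸ gain_mono l (hσord _ _ (Fin.le_def.2 (not_lt.1 h)))
        nlinarith [ht0 i]
    have hs := Finset.sum_le_sum (fun i (_ : i ∈ Finset.univ) => hb i)
    have he : ∑ i : Fin n, (if (i : ℕ) < k then gain l (σ i) - g0 else 0)
        = ∑ i : Fin k, (gain l (σ (Fin.castLE hklt.le i)) - g0) := by
      rw [← Finset.sum_filter]
      symm
      refine Finset.sum_bij (fun i _ => Fin.castLE hklt.le i) ?_ ?_ ?_ ?_
      · intro i _; simp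
      · intro a _ b _ h; exact Fin.castLE_injective _ h
      · intro b hb
        exact ⟨⟨b, (Finset.mem_filter.1 hb).2⟩, Finset.mem_univ _, rfl⟩
      · intro _ _; rfl
    rw [he] at hs
    simp only [mul_sub, Finset.sum_sub_distrib, ← Finset.sum_mul, Finset.sum_const,
      Finset.card_univ, Fintype.card_fin, nsmul_eq_mul] at hs
    nlinarith [mul_le_mul_of_nonneg_right htk hg0n]
  have hsum := Finset.sum_le_sum (fun j (_ : j ∈ Finset.univ) => hterm j)
  have hswap : ∑ j, -∑ i, R i j ^ 2 * (d j)⁻¹ * gain l (σ i) = -∑ i, t i * gain l (σ i) := by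
    rw [Finset.sum_neg_distrib, Finset.sum_comm, ht]
    simp only [Finset.sum_mul]
  rw [hswap] at hsum
  rw [obj_expand, ← hY, hQ]
  have e1 : (Pᵀ * Y).trace = ∑ j, ∑ i, P i j * Y i j := by
    simp [Matrix.trace, Matrix.mul_apply]
  have e2 : (Pᵀ * P * diagonal d).trace = ∑ j, d j * ∑ i, P i j ^ 2 := by
    simp only [Matrix.trace, diag_apply, mul_diagonal]
    refine Finset.sum_congr rfl fun j _ => ?_
    rw [Matrix.mul_apply, mul_comm]; simp [sq]
  have e3 : frobSq P = ∑ j, ∑ i, P i j ^ 2 := by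
    unfold frobSq; rw [Finset.sum_comm]
  have e4 : frobSq Q = ∑ j, d j := by
    rw [frobSq_trace, hQ, trace_diagonal]
  rw [e1, e2, e3, e4]
  simp only [add_mul, Finset.sum_add_distrib, ← Finset.mul_sum] at hsum
  linarith

lemma lower_all {m n k : ℕ} (X U : Matrix (Fin m) (Fin n) ℝ) (V : Matrix (Fin n) (Fin n) ℝ)
    (σ : Fin n → ℝ) (hU : Uᵀ * U = 1) (hV : Vᵀ * V = 1)
    (hσord : ∀ i j : Fin n, i ≤ j → σ j ≤ σ i) (hσnn : ∀ i, 0 ≤ σ i)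
    (hX : X = U * Matrix.diagonal σ * Vᵀ) (hklt : k < n) (l : ℝ) (hl : 0 < l)
    (P : Matrix (Fin m) (Fin k) ℝ) (Q : Matrix (Fin n) (Fin k) ℝ) :
    frobSq X - ∑ i : Fin k, gain l (σ (Fin.castLE hklt.le i)) ≤
      frobSq (X - P * Qᵀ) + l * (frobSq P + frobSq Q) := by
  obtain ⟨Z, d, hZ, hZd⟩ : ∃ (Z : Matrix (Fin k) (Fin k) ℝ) (d : Fin k → ℝ),
      Zᵀ * Z = 1 ∧ Zᵀ * (Qᵀ * Q) * Z = diagonal d := by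
    have hH : (Qᵀ * Q).IsHermitian := by
      simpa using Matrix.isHermitian_conjTranspose_mul_self Q
    have h1 : (hH.eigenvectorUnitary : Matrix (Fin k) (Fin k) ℝ)ᵀ * hH.eigenvectorUnitary = 1 := by
      have := Unitary.coe_star_mul_self hH.eigenvectorUnitary
      rwa [star_eq_conjTranspose, conjTranspose_eq_transpose_of_trivial] at this
    refine ⟨hH.eigenvectorUnitary, hH.eigenvalues, h1, ?_⟩
    have h2 := hH.spectral_theorem
    rw [Unitary.conjStarAlgAut_apply, star_eq_conjTranspose,
      conjTranspose_eq_transpose_of_trivial] at h2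
    generalize (hH.eigenvectorUnitary : Matrix (Fin k) (Fin k) ℝ) = W at *
    calc Wᵀ * (Qᵀ * Q) * W = Wᵀ * (W * diagonal (RCLike.ofReal ∘ hH.eigenvalues) * Wᵀ) * W :=
          congrArg (fun M => Wᵀ * M * W) h2
      _ = (Wᵀ * W) * diagonal (RCLike.ofReal ∘ hH.eigenvalues) * (Wᵀ * W) := by
          simp only [Matrix.mul_assoc]
      _ = _ := by rw [h1]; simp
  have hZ' : Z * Zᵀ = 1 := mul_eq_one_comm.mp hZ
  have h := lower_diag X U V σ hU hV hσord hσnn hX hklt l hl (P * Z) (Q * Z) d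
    (by rw [← hZd, transpose_mul]; simp only [Matrix.mul_assoc])
  have e1 : P * Z * (Q * Z)ᵀ = P * Qᵀ := by
    rw [transpose_mul, Matrix.mul_assoc, ← Matrix.mul_assoc Z, hZ', Matrix.one_mul]
  have e2 : ∀ {r : ℕ} (A : Matrix (Fin r) (Fin k) ℝ), frobSq (A * Z) = frobSq A := by
    intro r A
    rw [frobSq_trace, frobSq_trace, transpose_mul, Matrix.mul_assoc, trace_mul_comm,
      Matrix.mul_assoc, Matrix.mul_assoc, hZ', Matrix.mul_one]
  rwa [e1, e2, e2] at h

theorem stmt_11 {m n : ℕ} (hmn : n ≤ m)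
    (X U : Matrix (Fin m) (Fin n) ℝ) (V : Matrix (Fin n) (Fin n) ℝ)
    (σ : Fin n → ℝ)
    (hU : Uᵀ * U = 1) (hV : Vᵀ * V = 1)
    (hσord : ∀ i j : Fin n, i ≤ j → σ j ≤ σ i) (hσnn : ∀ i, 0 ≤ σ i)
    (hX : X = U * Matrix.diagonal σ * Vᵀ)
    (k : ℕ) (hk1 : 1 ≤ k) (hklt : k < n)
    (lam' : ℝ) (hlam'pos : 0 < lam')
    (hlam'lt : lam' < σ (⟨k - 1, by omega⟩ : Fin n))
    (hgap : σ (⟨k, by omega⟩ : Fin n) < σ (⟨k - 1, by omega⟩ : Fin n)) :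
    let Uk : Matrix (Fin m) (Fin k) ℝ := U.submatrix id (Fin.castLE hklt.le)
    let Vk : Matrix (Fin n) (Fin k) ℝ := V.submatrix id (Fin.castLE hklt.le)
    let D : Matrix (Fin k) (Fin k) ℝ := Matrix.diagonal (fun i : Fin k =>
      Real.sqrt (σ (Fin.castLE hklt.le i) - lam'))
    let Phat : Matrix (Fin m) (Fin k) ℝ := Uk * D
    let Qhat : Matrix (Fin n) (Fin k) ℝ := Vk * D
    (∀ (P : Matrix (Fin m) (Fin k) ℝ) (Q : Matrix (Fin n) (Fin k) ℝ),
        frobSq (X - Phat * Qhatᵀ) + lam' * (frobSq Phat + frobSq Qhat) ≤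
          frobSq (X - P * Qᵀ) + lam' * (frobSq P + frobSq Q)) ∧
    Phat * Qhatᵀ =
      Uk * Matrix.diagonal (fun i : Fin k => σ (Fin.castLE hklt.le i) - lam') * Vkᵀ := by
  intro Uk Vk D Phat Qhat
  have hs : ∀ i : Fin k, lam' < σ (Fin.castLE hklt.le i) := fun i =>
    lt_of_lt_of_le hlam'lt (hσord _ _ (Fin.le_def.2 (by have := i.2; simp; omega)))
  have hDD : D * D = diagonal (fun i : Fin k => σ (Fin.castLE hklt.le i) - lam') := by
    simp only [D, diagonal_mul_diagonal]
    congr 1; ext i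
    exact Real.mul_self_sqrt (by linarith [hs i])
  have hDT : Dᵀ = D := diagonal_transpose _
  refine ⟨?_, ?_⟩
  · intro P Q
    refine le_trans (le_of_eq ?_) (lower_all X U V σ hU hV hσord hσnn hX hklt lam' hlam'pos P Q)
    have sub1 : ∀ {r : ℕ} (A : Matrix (Fin r) (Fin n) ℝ), Aᵀ * A = 1 →
        Aᵀ * A.submatrix id (Fin.castLE hklt.le) =
          (1 : Matrix (Fin n) (Fin n) ℝ).submatrix id (Fin.castLE hklt.le) := by
      intro r A hA
      rw [← hA]; rfl
    have sub2 : ∀ {r : ℕ} (A : Matrix (Fin r) (Fin n) ℝ), Aᵀ * A = 1 →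
        (A.submatrix id (Fin.castLE hklt.le))ᵀ * A.submatrix id (Fin.castLE hklt.le) = 1 := by
      intro r A hA
      have : (A.submatrix id (Fin.castLE hklt.le))ᵀ * A.submatrix id (Fin.castLE hklt.le)
        = (Aᵀ * A).submatrix (Fin.castLE hklt.le) (Fin.castLE hklt.le) := rfl
      rw [this, hA, submatrix_one _ (Fin.castLE_injective _)]
    have hPP : Phatᵀ * Phat = D * D := by
      simp only [Phat]
      rw [transpose_mul, hDT, Matrix.mul_assoc, ← Matrix.mul_assoc Ukᵀ, sub2 U hU, Matrix.one_mul]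
    have hQQ : Qhatᵀ * Qhat = D * D := by
      simp only [Qhat]
      rw [transpose_mul, hDT, Matrix.mul_assoc, ← Matrix.mul_assoc Vkᵀ, sub2 V hV, Matrix.one_mul]
    have hmid : Ukᵀ * (X * Vk) = diagonal (fun i : Fin k => σ (Fin.castLE hklt.le i)) := by
      have a : Ukᵀ * U = (Uᵀ * Uk)ᵀ := by rw [transpose_mul, transpose_transpose]
      calc Ukᵀ * (X * Vk) = (Ukᵀ * U) * diagonal σ * (Vᵀ * Vk) := by
            rw [hX]; simp only [Matrix.mul_assoc]
        _ = _ := by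
            rw [a, sub1 U hU, sub1 V hV]
            ext i j
            rw [Matrix.mul_apply]
            simp [mul_diagonal, Matrix.one_apply, diagonal_apply]
            split_ifs with h
            · rw [h]
            · rfl
    have hPXQ : (Phatᵀ * (X * Qhat)).trace =
        ∑ i : Fin k, σ (Fin.castLE hklt.le i) * (σ (Fin.castLE hklt.le i) - lam') := by
      have : Phatᵀ * (X * Qhat) = D * ((Ukᵀ * (X * Vk)) * D) := by
        simp only [Phat, Qhat, transpose_mul, hDT, Matrix.mul_assoc]
      rw [this, trace_mul_comm, Matrix.mul_assoc, hDD, hmid, diagonal_mul_diagonal,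
        trace_diagonal]
    rw [obj_expand, hPXQ, frobSq_trace Phat, frobSq_trace Qhat, hPP, hQQ, hDD,
      diagonal_mul_diagonal, trace_diagonal, trace_diagonal]
    have hg : ∀ i : Fin k, gain lam' (σ (Fin.castLE hklt.le i)) =
        2 * (σ (Fin.castLE hklt.le i) * (σ (Fin.castLE hklt.le i) - lam'))
        - (σ (Fin.castLE hklt.le i) - lam') * (σ (Fin.castLE hklt.le i) - lam')
        - 2 * lam' * (σ (Fin.castLE hklt.le i) - lam') := by
      intro i
      unfold gain
      rw [max_eq_left (by linarith [hs i])]; ring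
    rw [Finset.sum_congr rfl (fun i _ => hg i)]
    simp only [Finset.sum_sub_distrib, ← Finset.mul_sum]
    ring
  · rw [← hDD]
    simp only [Phat, Qhat, transpose_mul, hDT, Matrix.mul_assoc]
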